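/- Let 𝔹 be an additive bivariant theory over a functoriality with good coproducts. Then: (1) 𝔹(∅ → Y) = 0 for every initial object ∅ and every object Y; (2) for every morphism X₁ ⊔ X₂ → Y, the map (ι₁_*, ι₂_*) : 𝔹(X₁ → Y) ⊕ 𝔹(X₂ → Y) → 𝔹(X₁ ⊔ X₂ → Y) is an isomorphism, whose inverse is α ↦ (θ(ι₁) • α, θ(ι₂) • α), where ι₁, ι₂ are the canonical inclusions into X₁ ⊔ X₂. -/

import Mathlib

open CategoryTheory CategoryTheory.Limits

universe w w' u' v u

/-- A bivariant functoriality on a category `C` with a final object and all fiber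
products: a class of confined morphisms (containing all isomorphisms, closed under
composition and pullback), a class of independent Cartesian squares (containing all
squares in which one pair of parallel sides consists of identities, closed under
horizontal and vertical composition) and a class of specialized morphisms
(containing all isomorphisms and closed under composition).

A square is recorded by its bottom `bot : X ⟶ Y`, top `top : X' ⟶ Y'`, left
vertical `l : X' ⟶ X` and right vertical `r : Y' ⟶ Y`; it is Cartesian when
`IsPullback top l r bot` holds. -/
structure BivFun (C : Type u) [Category.{v} C] where
  pt : C
  isTerminal_pt : IsTerminal pt
  hasPullbacks : HasPullbacks C
  confined : ∀ ⦃X Y : C⦄, (X ⟶ Y) → Prop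
  confined_of_isIso : ∀ ⦃X Y : C⦄ (f : X ⟶ Y), IsIso f → confined f
  confined_comp : ∀ ⦃X Y Z : C⦄ {f : X ⟶ Y} {g : Y ⟶ Z},
    confined f → confined g → confined (f ≫ g)
  confined_pullback : ∀ ⦃X Y X' Y' : C⦄ {bot : X ⟶ Y} {top : X' ⟶ Y'} {l : X' ⟶ X}
    {r : Y' ⟶ Y}, IsPullback top l r bot → confined bot → confined top
  indep : ∀ ⦃X Y X' Y' : C⦄ (bot : X ⟶ Y) (top : X' ⟶ Y') (l : X' ⟶ X) (r : Y' ⟶ Y), Prop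
  indep_isPullback : ∀ ⦃X Y X' Y' : C⦄ {bot : X ⟶ Y} {top : X' ⟶ Y'} {l : X' ⟶ X}
    {r : Y' ⟶ Y}, indep bot top l r → IsPullback top l r bot
  indep_vert_id : ∀ ⦃X Y : C⦄ (f : X ⟶ Y), indep f f (𝟙 X) (𝟙 Y)
  indep_horiz_id : ∀ ⦃X Y : C⦄ (f : X ⟶ Y), indep (𝟙 Y) (𝟙 X) f f
  indep_vcomp : ∀ ⦃X Y X' Y' X'' Y'' : C⦄ {f : X ⟶ Y} {f' : X' ⟶ Y'} {f'' : X'' ⟶ Y''}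
    {l : X' ⟶ X} {r : Y' ⟶ Y} {l' : X'' ⟶ X'} {r' : Y'' ⟶ Y'},
    indep f f' l r → indep f' f'' l' r' → indep f f'' (l' ≫ l) (r' ≫ r)
  indep_hcomp : ∀ ⦃X Y Z X' Y' Z' : C⦄ {f : X ⟶ Y} {g : Y ⟶ Z} {f' : X' ⟶ Y'}
    {g' : Y' ⟶ Z'} {l : X' ⟶ X} {m : Y' ⟶ Y} {r : Z' ⟶ Z},
    indep f f' l m → indep g g' m r → indep (f ≫ g) (f' ≫ g') l r
  specialized : ∀ ⦃X Y : C⦄, (X ⟶ Y) → Prop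
  specialized_of_isIso : ∀ ⦃X Y : C⦄ (f : X ⟶ Y), IsIso f → specialized f
  specialized_comp : ∀ ⦃X Y Z : C⦄ {f : X ⟶ Y} {g : Y ⟶ Z},
    specialized f → specialized g → specialized (f ≫ g)

variable {C : Type u} [Category.{v} C]

/-- The structure morphism to the final object `pt`. -/
def BivFun.tm (F : BivFun C) (X : C) : X ⟶ F.pt := F.isTerminal_pt.from X

/-- The data of a bivariant theory with functoriality `F`: an abelian group for every
morphism, bivariant pushforwards along confined morphisms, bivariant pullbacks along
independent squares, bivariant products, and units. -/
structure BivData (F : BivFun C) where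
  grp : ∀ ⦃X Y : C⦄, (X ⟶ Y) → Type w
  addCommGroup : ∀ ⦃X Y : C⦄ (f : X ⟶ Y), AddCommGroup (grp f)
  push : ∀ ⦃X X' Y : C⦄ (g : X ⟶ X') (h : X' ⟶ Y), F.confined g → grp (g ≫ h) → grp h
  pull : ∀ ⦃X Y X' Y' : C⦄ {bot : X ⟶ Y} {top : X' ⟶ Y'} {l : X' ⟶ X} {r : Y' ⟶ Y},
    F.indep bot top l r → grp bot → grp top
  mul : ∀ ⦃X Y Z : C⦄ {f : X ⟶ Y} {g : Y ⟶ Z}, grp f → grp g → grp (f ≫ g)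
  one : ∀ (X : C), grp (𝟙 X)

attribute [instance] BivData.addCommGroup

variable {F : BivFun C}

/-- Transport of bivariant elements along an equality of morphisms. -/
def BivData.tr (B : BivData.{w} F) {X Y : C} {f g : X ⟶ Y} (h : f = g) :
    B.grp f → B.grp g := fun a => h ▸ a

/-- The Fulton–MacPherson bivariant axioms. -/
structure IsBivTheory (B : BivData.{w} F) : Prop where
  push_add : ∀ ⦃X X' Y : C⦄ (g : X ⟶ X') (h : X' ⟶ Y) (hg : F.confined g)
    (α β : B.grp (g ≫ h)), B.push g h hg (α + β) = B.push g h hg α + B.push g h hg β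
  pull_add : ∀ ⦃X Y X' Y' : C⦄ {bot : X ⟶ Y} {top : X' ⟶ Y'} {l : X' ⟶ X} {r : Y' ⟶ Y}
    (hsq : F.indep bot top l r) (α β : B.grp bot),
    B.pull hsq (α + β) = B.pull hsq α + B.pull hsq β
  mul_add_left : ∀ ⦃X Y Z : C⦄ {f : X ⟶ Y} {g : Y ⟶ Z} (α α' : B.grp f) (β : B.grp g),
    B.mul (α + α') β = B.mul α β + B.mul α' β
  mul_add_right : ∀ ⦃X Y Z : C⦄ {f : X ⟶ Y} {g : Y ⟶ Z} (α : B.grp f) (β β' : B.grp g),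
    B.mul α (β + β') = B.mul α β + B.mul α β'
  mul_assoc : ∀ ⦃X Y Z W : C⦄ {f : X ⟶ Y} {g : Y ⟶ Z} {h : Z ⟶ W}
    (α : B.grp f) (β : B.grp g) (γ : B.grp h),
    B.mul (B.mul α β) γ = B.tr (Category.assoc f g h).symm (B.mul α (B.mul β γ))
  push_id : ∀ ⦃X Y : C⦄ (f : X ⟶ Y) (h1 : F.confined (𝟙 X)) (α : B.grp (𝟙 X ≫ f)),
    B.push (𝟙 X) f h1 α = B.tr (Category.id_comp f) α
  push_comp : ∀ ⦃X X' X'' Y : C⦄ (f : X ⟶ X') (g : X' ⟶ X'') (h : X'' ⟶ Y)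
    (hf : F.confined f) (hg : F.confined g) (α : B.grp (f ≫ g ≫ h)),
    B.push g h hg (B.push f (g ≫ h) hf α) =
      B.push (f ≫ g) h (F.confined_comp hf hg) (B.tr (Category.assoc f g h).symm α)
  pull_id : ∀ ⦃X Y : C⦄ (f : X ⟶ Y) (α : B.grp f), B.pull (F.indep_vert_id f) α = α
  pull_comp : ∀ ⦃X Y X' Y' X'' Y'' : C⦄ {f : X ⟶ Y} {f' : X' ⟶ Y'} {f'' : X'' ⟶ Y''}
    {l : X' ⟶ X} {r : Y' ⟶ Y} {l' : X'' ⟶ X'} {r' : Y'' ⟶ Y'}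
    (h1 : F.indep f f' l r) (h2 : F.indep f' f'' l' r') (α : B.grp f),
    B.pull h2 (B.pull h1 α) = B.pull (F.indep_vcomp h1 h2) α
  push_mul : ∀ ⦃X X' Y Z : C⦄ (f : X ⟶ X') (h : X' ⟶ Y) (g : Y ⟶ Z) (hf : F.confined f)
    (α : B.grp (f ≫ h)) (β : B.grp g),
    B.push f (h ≫ g) hf (B.tr (Category.assoc f h g) (B.mul α β)) =
      B.mul (B.push f h hf α) β
  pull_mul : ∀ ⦃X Y Z X' Y' Z' : C⦄ {f : X ⟶ Y} {g : Y ⟶ Z} {f' : X' ⟶ Y'} {g' : Y' ⟶ Z'}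
    {l : X' ⟶ X} {m : Y' ⟶ Y} {r : Z' ⟶ Z}
    (h1 : F.indep f f' l m) (h2 : F.indep g g' m r) (α : B.grp f) (β : B.grp g),
    B.pull (F.indep_hcomp h1 h2) (B.mul α β) = B.mul (B.pull h1 α) (B.pull h2 β)
  push_pull : ∀ ⦃X Y Z X' Y' Z' : C⦄ (f : X ⟶ Y) (k : Y ⟶ Z) (f' : X' ⟶ Y') (k' : Y' ⟶ Z')
    (l : X' ⟶ X) (m : Y' ⟶ Y) (r : Z' ⟶ Z) (hf : F.confined f)
    (hleft : IsPullback f' l m f) (hbig : F.indep (f ≫ k) (f' ≫ k') l r)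
    (hright : F.indep k k' m r) (α : B.grp (f ≫ k)),
    B.pull hright (B.push f k hf α) =
      B.push f' k' (F.confined_pullback hleft hf) (B.pull hbig α)
  proj_formula : ∀ ⦃X Y X' Y' Z : C⦄ {b : X' ⟶ Y'} {t : X ⟶ Y} {g' : X ⟶ X'} {g : Y ⟶ Y'}
    (hsq : F.indep b t g' g) (hg : F.confined g) (c : Y' ⟶ Z)
    (α : B.grp (g ≫ c)) (β : B.grp b),
    B.push g' (b ≫ c) (F.confined_pullback (F.indep_isPullback hsq).flip hg)
        (B.tr (by rw [← Category.assoc, (F.indep_isPullback hsq).w, Category.assoc])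
          (B.mul (B.pull hsq β) α)) =
      B.mul β (B.push g c hg α)
  one_mul : ∀ ⦃X Y : C⦄ {f : X ⟶ Y} (α : B.grp f),
    B.tr (Category.id_comp f) (B.mul (B.one X) α) = α
  mul_one : ∀ ⦃X Y : C⦄ {f : X ⟶ Y} (α : B.grp f),
    B.tr (Category.comp_id f) (B.mul α (B.one Y)) = α

/-- The cohomology pullback `f^* : 𝔹^•(Y) → 𝔹^•(X)` along an arbitrary morphism, using
the independent square whose horizontal sides are `f` and whose vertical sides are
identities. -/
def cohPull (B : BivData.{w} F) {X Y : C} (f : X ⟶ Y) : B.grp (𝟙 Y) → B.grp (𝟙 X) :=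
  B.pull (F.indep_horiz_id f)

/-- The ring multiplication on the cohomology `𝔹^•(X) = 𝔹(𝟙 X)`. -/
def cohMul (B : BivData.{w} F) {X : C} (α β : B.grp (𝟙 X)) : B.grp (𝟙 X) :=
  B.tr (Category.id_comp (𝟙 X)) (B.mul α β)

/-- The homology pushforward `f_* : 𝔹_•(X) → 𝔹_•(Y)` along a confined morphism. -/
def homPush (B : BivData.{w} F) {X Y : C} (f : X ⟶ Y) (hf : F.confined f) :
    B.grp (F.tm X) → B.grp (F.tm Y) :=
  fun a => B.push f (F.tm Y) hf (B.tr (F.isTerminal_pt.hom_ext _ _) a)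

/-- The left action of the cohomology ring `𝔹^•(X)` on the homology `𝔹_•(X)`. -/
def cohSmul (B : BivData.{w} F) {X : C} (α : B.grp (𝟙 X)) (a : B.grp (F.tm X)) :
    B.grp (F.tm X) :=
  B.tr (Category.id_comp (F.tm X)) (B.mul α a)

/-- An orientation of a bivariant theory: a canonical element `θ(f)` for every
specialized morphism, normalized and multiplicative. -/
structure BivOrientation (B : BivData.{w} F) where
  θ : ∀ ⦃X Y : C⦄ (f : X ⟶ Y), F.specialized f → B.grp f
  θ_id : ∀ (X : C), θ (𝟙 X) (F.specialized_of_isIso (𝟙 X) inferInstance) = B.one X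
  θ_comp : ∀ ⦃X Y Z : C⦄ (f : X ⟶ Y) (g : Y ⟶ Z) (hf : F.specialized f)
    (hg : F.specialized g),
    θ (f ≫ g) (F.specialized_comp hf hg) = B.mul (θ f hf) (θ g hg)

/-- A stable orientation: specialized morphisms are stable under independent
pullbacks, and the orientation is stable under independent pullbacks. -/
structure StableOrientation (B : BivData.{w} F) extends BivOrientation B where
  specialized_pullback : ∀ ⦃X Y X' Y' : C⦄ {bot : X ⟶ Y} {top : X' ⟶ Y'} {l : X' ⟶ X}
    {r : Y' ⟶ Y}, F.indep bot top l r → F.specialized bot → F.specialized top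
  θ_pullback : ∀ ⦃X Y X' Y' : C⦄ {bot : X ⟶ Y} {top : X' ⟶ Y'} {l : X' ⟶ X}
    {r : Y' ⟶ Y} (hsq : F.indep bot top l r) (hs : F.specialized bot),
    B.pull hsq (θ bot hs) = θ top (specialized_pullback hsq hs)

variable {B : BivData.{w} F}

/-- The Gysin pushforward `f_! : 𝔹^•(X) → 𝔹^•(Y)`, `f_!(α) = f_*(α • θ(f))`, along a
confined and specialized morphism. -/
def BivOrientation.gysinPush (O : BivOrientation B) {X Y : C} (f : X ⟶ Y)
    (hc : F.confined f) (hs : F.specialized f) : B.grp (𝟙 X) → B.grp (𝟙 Y) :=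
  fun α => B.push f (𝟙 Y) hc
    (B.tr (show 𝟙 X ≫ f = f ≫ 𝟙 Y by simp) (B.mul α (O.θ f hs)))

/-- The Gysin pullback `g^! : 𝔹_•(Y) → 𝔹_•(X)`, `g^!(β) = θ(g) • β`, along a
specialized morphism. -/
def BivOrientation.gysinPull (O : BivOrientation B) {X Y : C} (g : X ⟶ Y)
    (hs : F.specialized g) : B.grp (F.tm Y) → B.grp (F.tm X) :=
  fun a => B.tr (F.isTerminal_pt.hom_ext _ _) (B.mul (O.θ g hs) a)

/-- `f : X ⟶ S` is a canonical inclusion into a (binary) coproduct. -/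
def IsCoprodIncl {X S : C} (f : X ⟶ S) : Prop :=
  ∃ (Y : C) (g : Y ⟶ S),
    Nonempty (IsColimit (BinaryCofan.mk f g)) ∨ Nonempty (IsColimit (BinaryCofan.mk g f))

/-- The bivariant functoriality has good coproducts: `𝒞` has finite coproducts; no
non-initial object maps to an initial object; a morphism out of a coproduct is
confined (resp. specialized) iff both of its restrictions are; the squares expressing
disjointness of the canonical inclusions and the base change of a coproduct
decomposition are Cartesian; and every Cartesian square having a canonical coproduct
inclusion as a side is independent. -/
structure GoodCoproducts (F : BivFun C) : Prop where
  hasInitial : HasInitial C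
  hasBinaryCoproducts : HasBinaryCoproducts C
  no_map_to_initial : ∀ ⦃X E : C⦄, IsInitial E → (X ⟶ E) → Nonempty (IsInitial X)
  confined_iff : ∀ ⦃X Y S Z : C⦄ (ι₁ : X ⟶ S) (ι₂ : Y ⟶ S),
    Nonempty (IsColimit (BinaryCofan.mk ι₁ ι₂)) → ∀ (f : S ⟶ Z),
    (F.confined f ↔ F.confined (ι₁ ≫ f) ∧ F.confined (ι₂ ≫ f))
  specialized_iff : ∀ ⦃X Y S Z : C⦄ (ι₁ : X ⟶ S) (ι₂ : Y ⟶ S),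
    Nonempty (IsColimit (BinaryCofan.mk ι₁ ι₂)) → ∀ (f : S ⟶ Z),
    (F.specialized f ↔ F.specialized (ι₁ ≫ f) ∧ F.specialized (ι₂ ≫ f))
  disjoint_cartesian : ∀ ⦃X Y S E : C⦄ (ι₁ : X ⟶ S) (ι₂ : Y ⟶ S),
    Nonempty (IsColimit (BinaryCofan.mk ι₁ ι₂)) → ∀ (hE : IsInitial E),
    IsPullback (hE.to X) (hE.to Y) ι₁ ι₂
  basechange_cartesian : ∀ ⦃X Y S Z Z' X' Y' S' : C⦄ (ι₁ : X ⟶ S) (ι₂ : Y ⟶ S),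
    Nonempty (IsColimit (BinaryCofan.mk ι₁ ι₂)) →
    ∀ (f : S ⟶ Z) (g : Z' ⟶ Z) (pX : X' ⟶ X) (qX : X' ⟶ Z') (pY : Y' ⟶ Y)
      (qY : Y' ⟶ Z'),
    IsPullback qX pX g (ι₁ ≫ f) → IsPullback qY pY g (ι₂ ≫ f) →
    ∀ (ι₁' : X' ⟶ S') (ι₂' : Y' ⟶ S'),
    Nonempty (IsColimit (BinaryCofan.mk ι₁' ι₂')) →
    ∀ (t : S' ⟶ Z') (l : S' ⟶ S), ι₁' ≫ t = qX → ι₂' ≫ t = qY →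
      ι₁' ≫ l = pX ≫ ι₁ → ι₂' ≫ l = pY ≫ ι₂ → IsPullback t l g f
  incl_indep : ∀ ⦃X Y X' Y' : C⦄ {bot : X ⟶ Y} {top : X' ⟶ Y'} {l : X' ⟶ X}
    {r : Y' ⟶ Y}, IsPullback top l r bot →
    (IsCoprodIncl bot ∨ IsCoprodIncl top ∨ IsCoprodIncl l ∨ IsCoprodIncl r) →
    F.indep bot top l r

/-- A well oriented and additive bivariant theory over a functoriality with good
coproducts: the orientations of the canonical coproduct inclusions are stable under
independent pullbacks, and for every finite coproduct `X = ⨿ᵢ Xᵢ` with canonical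
inclusions `ιᵢ` (which are confined and specialized) one has
`Σᵢ ιᵢ_*(θ(ιᵢ)) = 1_X`. -/
structure IsAdditive (B : BivData.{w} F) (O : BivOrientation B)
    (D : GoodCoproducts F) : Prop where
  well_oriented : ∀ ⦃X Y X' Y' : C⦄ {bot : X ⟶ Y} {top : X' ⟶ Y'} {l : X' ⟶ X}
    {r : Y' ⟶ Y} (hsq : F.indep bot top l r), IsCoprodIncl bot →
    ∀ (hbs : F.specialized bot) (hts : F.specialized top),
    B.pull hsq (O.θ bot hbs) = O.θ top hts
  additive : ∀ (n : ℕ) (Xs : Fin n → C) (S : C) (ι : ∀ i, Xs i ⟶ S),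
    Nonempty (IsColimit (Cofan.mk S ι)) →
    ∀ (hc : ∀ i, F.confined (ι i)) (hs : ∀ i, F.specialized (ι i)),
    (Finset.univ.sum fun i =>
      B.push (ι i) (𝟙 S) (hc i)
        (B.tr (Category.comp_id (ι i)).symm (O.θ (ι i) (hs i)))) = B.one S

theorem BivData.tr_tr (B : BivData.{w} F) {X Y : C} {f g h : X ⟶ Y} (p : f = g) (q : g = h)
    (a : B.grp f) : B.tr q (B.tr p a) = B.tr (p.trans q) a := by
  subst p q
  rfl

theorem BivData.tr_add (B : BivData.{w} F) {X Y : C} {f g : X ⟶ Y} (p : f = g)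
    (a b : B.grp f) : B.tr p (a + b) = B.tr p a + B.tr p b := by
  subst p
  rfl

theorem BivData.tr_zero (B : BivData.{w} F) {X Y : C} {f g : X ⟶ Y} (p : f = g) :
    B.tr p (0 : B.grp f) = 0 := by
  subst p
  rfl

theorem BivData.tr_push (B : BivData.{w} F) {X X' Y : C} (g : X ⟶ X') {h h' : X' ⟶ Y}
    (p : h = h') (hg : F.confined g) (a : B.grp (g ≫ h)) :
    B.tr p (B.push g h hg a) = B.push g h' hg (B.tr (congrArg (g ≫ ·) p) a) := by
  subst p
  rfl

theorem BivData.mul_tr_left (B : BivData.{w} F) {X Y Z : C} {f f' : X ⟶ Y} {g : Y ⟶ Z}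
    (p : f = f') (a : B.grp f) (b : B.grp g) :
    B.mul (B.tr p a) b = B.tr (congrArg (· ≫ g) p) (B.mul a b) := by
  subst p
  rfl

theorem IsBivTheory.push_zero (hB : IsBivTheory B) {X X' Y : C} (g : X ⟶ X') (h : X' ⟶ Y)
    (hg : F.confined g) : B.push g h hg 0 = 0 := by
  simpa using hB.push_add g h hg 0 0

theorem IsBivTheory.zero_mul (hB : IsBivTheory B) {X Y Z : C} {f : X ⟶ Y} {g : Y ⟶ Z}
    (β : B.grp g) : B.mul (0 : B.grp f) β = 0 := by
  simpa using hB.mul_add_left (0 : B.grp f) 0 β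

/-- Canonical coproduct inclusions are monomorphisms. -/
theorem GoodCoproducts.mono_inl (D : GoodCoproducts F) {X Y S : C} (ι₁ : X ⟶ S) (ι₂ : Y ⟶ S)
    (h : Nonempty (IsColimit (BinaryCofan.mk ι₁ ι₂))) : Mono ι₁ := by
  have := F.hasPullbacks
  have := D.hasInitial
  have hE : IsInitial (⊥_ C) := initialIsInitial
  have hP : IsPullback (pullback.fst ι₁ ι₁) (pullback.snd ι₁ ι₁) ι₁ ι₁ :=
    IsPullback.of_hasPullback ι₁ ι₁
  have hcoprod : Nonempty (IsColimit (BinaryCofan.mk (𝟙 (pullback ι₁ ι₁))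
      (hE.to (pullback ι₁ ι₁)))) :=
    ⟨BinaryCofan.isColimitMk (fun s => s.inl) (fun _ => Category.id_comp _)
      (fun _ => hE.hom_ext _ _)
      (fun _ _ hm _ => (Category.id_comp _).symm.trans hm)⟩
  have hsq := D.basechange_cartesian ι₁ ι₂ h (𝟙 S) ι₁ (pullback.snd ι₁ ι₁)
    (pullback.fst ι₁ ι₁) (hE.to Y) (hE.to X) (by simpa using hP)
    (by simpa using D.disjoint_cartesian ι₁ ι₂ h hE) _ _ hcoprod
    (pullback.fst ι₁ ι₁) (pullback.snd ι₁ ι₁ ≫ ι₁) (by simp) (hE.hom_ext _ _) (by simp)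
    (hE.hom_ext _ _)
  have : IsIso (pullback.fst ι₁ ι₁) := hsq.isIso_fst_of_isIso
  exact IsKernelPair.mono_of_isIso_fst hP

theorem IsAdditive.eq_zero_of_isInitial (hB : IsBivTheory B) {D : GoodCoproducts F}
    {O : BivOrientation B} (hAdd : IsAdditive B O D) {E Y : C} (hE : IsInitial E)
    (f : E ⟶ Y) (a : B.grp f) : a = 0 := by
  have h1 : B.one E = 0 := by
    rw [← hAdd.additive 0 (fun i => i.elim0) E (fun i => i.elim0)
      ⟨Cofan.IsColimit.mk _ (fun s => hE.to s.pt) (fun _ i => i.elim0)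
        (fun _ _ _ => hE.hom_ext _ _)⟩ (fun i => i.elim0) (fun i => i.elim0)]
    simp
  rw [← hB.one_mul a, h1, hB.zero_mul, B.tr_zero]

theorem IsAdditive.push_mul_orientation_add (hB : IsBivTheory B) {D : GoodCoproducts F}
    {O : BivOrientation B} (hAdd : IsAdditive B O D) {X₁ X₂ S Y : C} (ι₁ : X₁ ⟶ S)
    (ι₂ : X₂ ⟶ S) (h : Nonempty (IsColimit (BinaryCofan.mk ι₁ ι₂))) (φ : S ⟶ Y)
    (hc₁ : F.confined ι₁) (hc₂ : F.confined ι₂)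
    (hs₁ : F.specialized ι₁) (hs₂ : F.specialized ι₂) (α : B.grp φ) :
    B.push ι₁ φ hc₁ (B.mul (O.θ ι₁ hs₁) α) + B.push ι₂ φ hc₂ (B.mul (O.θ ι₂ hs₂) α) = α := by
  obtain ⟨hl⟩ := h
  have hcofan : Nonempty (IsColimit (Cofan.mk S
      (Fin.cons ι₁ (Fin.cons ι₂ fun i => i.elim0) :
        ∀ i : Fin 2, (Fin.cons X₁ (Fin.cons X₂ fun i => i.elim0) : Fin 2 → C) i ⟶ S))) :=
    ⟨Cofan.IsColimit.mk _ (fun s => hl.desc (BinaryCofan.mk (s.inj 0) (s.inj 1)))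
      (fun s i => by
        fin_cases i
        · exact hl.fac (BinaryCofan.mk (s.inj 0) (s.inj 1)) ⟨WalkingPair.left⟩
        · exact hl.fac (BinaryCofan.mk (s.inj 0) (s.inj 1)) ⟨WalkingPair.right⟩)
      (fun s m hm => BinaryCofan.IsColimit.hom_ext hl
        ((hm 0).trans (hl.fac (BinaryCofan.mk (s.inj 0) (s.inj 1)) ⟨WalkingPair.left⟩).symm)
        ((hm 1).trans (hl.fac (BinaryCofan.mk (s.inj 0) (s.inj 1)) ⟨WalkingPair.right⟩).symm))⟩
  have hsum := hAdd.additive 2 _ S _ hcofan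
    (Fin.cons hc₁ (Fin.cons hc₂ fun i => i.elim0))
    (Fin.cons hs₁ (Fin.cons hs₂ fun i => i.elim0))
  rw [Fin.sum_univ_two] at hsum
  change B.push ι₁ (𝟙 S) hc₁ (B.tr (Category.comp_id ι₁).symm (O.θ ι₁ hs₁)) +
    B.push ι₂ (𝟙 S) hc₂ (B.tr (Category.comp_id ι₂).symm (O.θ ι₂ hs₂)) = B.one S at hsum
  conv_rhs => rw [← hB.one_mul α, ← hsum]
  rw [hB.mul_add_left, ← hB.push_mul, ← hB.push_mul, B.tr_add, B.tr_push, B.tr_push,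
    B.mul_tr_left, B.mul_tr_left, B.tr_tr, B.tr_tr, B.tr_tr, B.tr_tr]
  rfl

theorem IsAdditive.orientation_mul_push_self (hB : IsBivTheory B) {D : GoodCoproducts F}
    {O : BivOrientation B} (hAdd : IsAdditive B O D) {X S Y : C} (ι : X ⟶ S)
    (hι : IsCoprodIncl ι) [Mono ι] (φ : S ⟶ Y) (hc : F.confined ι)
    (hs : F.specialized ι) (a : B.grp (ι ≫ φ)) :
    B.mul (O.θ ι hs) (B.push ι φ hc a) = a := by
  have hsq : F.indep ι (𝟙 X) (𝟙 X) ι :=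
    D.incl_indep (IsKernelPair.id_of_mono ι) (Or.inl hι)
  rw [← hB.proj_formula hsq hc φ a (O.θ ι hs),
    hAdd.well_oriented hsq hι hs (F.specialized_of_isIso _ inferInstance), O.θ_id, hB.push_id,
    B.tr_tr]
  exact hB.one_mul a

theorem IsAdditive.orientation_mul_push_other (hB : IsBivTheory B) {D : GoodCoproducts F}
    {O : BivOrientation B} (hAdd : IsAdditive B O D) {X₁ X₂ S Y : C} (ι₁ : X₁ ⟶ S)
    (ι₂ : X₂ ⟶ S) (h : Nonempty (IsColimit (BinaryCofan.mk ι₁ ι₂))) (φ : S ⟶ Y)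
    (hc₂ : F.confined ι₂) (hs₁ : F.specialized ι₁) (b : B.grp (ι₂ ≫ φ)) :
    B.mul (O.θ ι₁ hs₁) (B.push ι₂ φ hc₂ b) = 0 := by
  have := D.hasInitial
  have hE : IsInitial (⊥_ C) := initialIsInitial
  have hsq : F.indep ι₁ (hE.to X₂) (hE.to X₁) ι₂ :=
    D.incl_indep (D.disjoint_cartesian ι₁ ι₂ h hE).flip (Or.inl ⟨X₂, ι₂, Or.inl h⟩)
  rw [← hB.proj_formula hsq hc₂ φ b (O.θ ι₁ hs₁),
    hAdd.eq_zero_of_isInitial hB hE _ (B.tr _ _), hB.push_zero]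

theorem IsAdditive.orientation_mul_push_add (hB : IsBivTheory B) {D : GoodCoproducts F}
    {O : BivOrientation B} (hAdd : IsAdditive B O D) {X₁ X₂ S Y : C} (ι₁ : X₁ ⟶ S)
    (ι₂ : X₂ ⟶ S) (h : Nonempty (IsColimit (BinaryCofan.mk ι₁ ι₂))) (φ : S ⟶ Y)
    (hc₁ : F.confined ι₁) (hc₂ : F.confined ι₂) (hs₁ : F.specialized ι₁)
    (a : B.grp (ι₁ ≫ φ)) (b : B.grp (ι₂ ≫ φ)) :
    B.mul (O.θ ι₁ hs₁) (B.push ι₁ φ hc₁ a + B.push ι₂ φ hc₂ b) = a := by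
  have := D.mono_inl ι₁ ι₂ h
  rw [hB.mul_add_right, hAdd.orientation_mul_push_self hB ι₁ ⟨X₂, ι₂, Or.inl h⟩ φ,
    hAdd.orientation_mul_push_other hB ι₁ ι₂ h φ, add_zero]

/-- Let `𝔹` be an additive bivariant theory over a functoriality
with good coproducts.  Then: (1) `𝔹(∅ → Y) = 0` for every initial object `∅` and
every object `Y`; (2) for every morphism `X₁ ⊔ X₂ ⟶ Y` (with the canonical
inclusions `ι₁, ι₂`, which are confined and specialized), the map
`(ι₁_*, ι₂_*) : 𝔹(X₁ → Y) ⊕ 𝔹(X₂ → Y) → 𝔹(X₁ ⊔ X₂ → Y)` is an isomorphism, whose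
inverse is `α ↦ (θ(ι₁) • α, θ(ι₂) • α)`. -/
theorem additive_theory_coproduct_decomposition {C : Type u} [Category.{v} C]
    (F : BivFun C) (B : BivData.{w} F) (hB : IsBivTheory B)
    (D : GoodCoproducts F) (O : BivOrientation B) (hAdd : IsAdditive B O D) :
    (∀ (E Y : C), IsInitial E → ∀ (f : E ⟶ Y) (a : B.grp f), a = 0) ∧
    (∀ (X₁ X₂ S Y : C) (ι₁ : X₁ ⟶ S) (ι₂ : X₂ ⟶ S),
      Nonempty (IsColimit (BinaryCofan.mk ι₁ ι₂)) →
      ∀ (φ : S ⟶ Y) (hc₁ : F.confined ι₁) (hc₂ : F.confined ι₂)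
        (hs₁ : F.specialized ι₁) (hs₂ : F.specialized ι₂),
      Function.Bijective
        (fun p : B.grp (ι₁ ≫ φ) × B.grp (ι₂ ≫ φ) =>
          B.push ι₁ φ hc₁ p.1 + B.push ι₂ φ hc₂ p.2) ∧
      (∀ α : B.grp φ,
        B.push ι₁ φ hc₁ (B.mul (O.θ ι₁ hs₁) α) +
          B.push ι₂ φ hc₂ (B.mul (O.θ ι₂ hs₂) α) = α) ∧
      (∀ (a : B.grp (ι₁ ≫ φ)) (b : B.grp (ι₂ ≫ φ)),
        B.mul (O.θ ι₁ hs₁) (B.push ι₁ φ hc₁ a + B.push ι₂ φ hc₂ b) = a ∧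
        B.mul (O.θ ι₂ hs₂) (B.push ι₁ φ hc₁ a + B.push ι₂ φ hc₂ b) = b)) := by
  refine ⟨fun E Y hE f a => hAdd.eq_zero_of_isInitial hB hE f a, ?_⟩
  intro X₁ X₂ S Y ι₁ ι₂ h φ hc₁ hc₂ hs₁ hs₂
  have hright := hAdd.push_mul_orientation_add hB ι₁ ι₂ h φ hc₁ hc₂ hs₁ hs₂
  have hleft : ∀ (a : B.grp (ι₁ ≫ φ)) (b : B.grp (ι₂ ≫ φ)),
      B.mul (O.θ ι₁ hs₁) (B.push ι₁ φ hc₁ a + B.push ι₂ φ hc₂ b) = a ∧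
      B.mul (O.θ ι₂ hs₂) (B.push ι₁ φ hc₁ a + B.push ι₂ φ hc₂ b) = b := fun a b =>
    ⟨hAdd.orientation_mul_push_add hB ι₁ ι₂ h φ hc₁ hc₂ hs₁ a b, by
      rw [add_comm]
      exact hAdd.orientation_mul_push_add hB ι₂ ι₁ (h.map BinaryCofan.isColimitFlip) φ
        hc₂ hc₁ hs₂ b a⟩
  exact ⟨Function.bijective_iff_has_inverse.2
    ⟨fun α => (B.mul (O.θ ι₁ hs₁) α, B.mul (O.θ ι₂ hs₂) α),
      fun p => Prod.ext (hleft p.1 p.2).1 (hleft p.1 p.2).2, hright⟩, hright, hleft⟩
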